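/- Let (C, μ) be a flat-foldable MV pattern and α = (c_i, …, c_{i+k}) a crimpable sequence of C with k + 1 odd (so k is even). Then any maximal sequence of monocrimps, each performed at an adjacent pair of the remaining creases of α whose two creases have opposite μ-values, removes all but exactly one crease of α; moreover, the μ-value of the surviving crease is the majority value, i.e., the value taken by exactly k/2 + 1 of the creases of α (each monocrimp removing one M crease and one V crease). -/

import Mathlib

/-- Mountain or valley label for a crease. -/
inductive MV : Type
  | M : MV
  | V : MV
deriving DecidableEq

/-- `(c 0, c 1, …, c n)` is a 1D crease pattern: a strictly increasing finite
sequence of reals with `n ≥ 1`.  The points `c 1, …, c (n-1)` are its creases,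
`c 0` and `c n` its ends. -/
def IsCreasePattern (n : ℕ) (c : ℕ → ℝ) : Prop :=
  1 ≤ n ∧ ∀ i j : ℕ, i < j → j ≤ n → c i < c j

/-- The consecutive creases `(c i, …, c (i+k))` form a crimpable sequence with gap `d`. -/
def IsCrimpable (n : ℕ) (c : ℕ → ℝ) (i k : ℕ) (d : ℝ) : Prop :=
  1 ≤ i ∧ 1 ≤ k ∧ i + k ≤ n - 1 ∧
  (∀ m : ℕ, i ≤ m → m < i + k → c (m + 1) - c m = d) ∧
  d < c i - c (i - 1) ∧ d < c (i + k + 1) - c (i + k)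

/-- Additive offset of the folded-position map on the `j`-th interval:
on `[c j, c (j+1)]` the folded-position map is `x ↦ (-1)^j * x + foldOffset c j`. -/
def foldOffset (c : ℕ → ℝ) : ℕ → ℝ
  | 0 => 0
  | j + 1 => foldOffset c (j) + 2 * (-1 : ℝ) ^ j * c (j + 1)

/-- Folded position of a point `x` belonging to the `j`-th interval `[c j, c (j+1)]`.
This is the unique continuous map equal to the identity on `[c 0, c 1]`, isometric on
every interval, and reversing direction at every crease. -/
def foldPos (c : ℕ → ℝ) (j : ℕ) (x : ℝ) : ℝ := (-1 : ℝ) ^ j * x + foldOffset c j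

/-- Folded position of the crease `c i`. -/
def foldCrease (c : ℕ → ℝ) (i : ℕ) : ℝ := foldPos c i (c i)

/-- `x` lies strictly `lt`-between `a` and `b`. -/
def Between (lt : ℕ → ℕ → Prop) (a b x : ℕ) : Prop :=
  (lt a x ∧ lt x b) ∨ (lt b x ∧ lt x a)

/-- The MV pattern `(C, μ)` is flat-foldable: there is a strict linear order `lt`
("strictly below") on the intervals `I_0, …, I_{n-1}` (indexed `0, …, n-1`) such that:
(i) for each crease `i`, `I_{i-1}` is below `I_i` iff either `μ i = V` and the folded map
is increasing on `I_{i-1}` (slope `(-1)^(i-1) = 1`), or `μ i = M` and it is decreasing;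
(ii) for each crease `i` and each interval `J` whose folded image contains the folded
crease position in its interior, `J` is not strictly between `I_{i-1}` and `I_i`;
(iii) for distinct creases `i, j` folding to the same point, it is not the case that
exactly one of `I_{j-1}`, `I_j` is strictly between `I_{i-1}` and `I_i`. -/
def IsFlatFoldable (n : ℕ) (c : ℕ → ℝ) (μ : ℕ → MV) : Prop :=
  ∃ lt : ℕ → ℕ → Prop,
    (∀ j, j < n → ¬ lt j j) ∧
    (∀ a b e, lt a b → lt b e → lt a e) ∧
    (∀ a b, a < n → b < n → a ≠ b → lt a b ∨ lt b a) ∧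
    (∀ a b, lt a b → a < n ∧ b < n) ∧
    (∀ i, 1 ≤ i → i ≤ n - 1 →
      (lt (i - 1) i ↔ ((μ i = MV.V ∧ Even (i - 1)) ∨ (μ i = MV.M ∧ Odd (i - 1))))) ∧
    (∀ i, 1 ≤ i → i ≤ n - 1 → ∀ j, j < n →
      foldCrease c i ∈
        Set.Ioo (min (foldPos c j (c j)) (foldPos c j (c (j + 1))))
                (max (foldPos c j (c j)) (foldPos c j (c (j + 1)))) →
      ¬ Between lt (i - 1) i j) ∧
    (∀ i j, 1 ≤ i → i ≤ n - 1 → 1 ≤ j → j ≤ n - 1 → i ≠ j →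
      foldCrease c i = foldCrease c j →
      (Between lt (i - 1) i (j - 1) ↔ Between lt (i - 1) i j))

/-- `F` is a forcing set for the MV pattern `(C, μ)`: a set of creases such that the only
flat-foldable assignment agreeing with `μ` on `F` is `μ` itself (on all creases). -/
def IsForcingSet (n : ℕ) (c : ℕ → ℝ) (μ : ℕ → MV) (F : Set ℕ) : Prop :=
  F ⊆ Set.Icc 1 (n - 1) ∧
  ∀ ν : ℕ → MV, IsFlatFoldable n c ν → (∀ x ∈ F, ν x = μ x) →
    ∀ x, 1 ≤ x → x ≤ n - 1 → ν x = μ x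

/-- The crease pattern produced by a monocrimp at the adjacent pair `(c j, c (j+1))`:
it deletes `c j` and `c (j+1)` and translates all later points by `-2 * (c (j+1) - c j)`. -/
def monocrimpPattern (c : ℕ → ℝ) (j : ℕ) : ℕ → ℝ :=
  fun x => if x < j then c x else c (x + 2) - 2 * (c (j + 1) - c j)

/-- A state of the folding process: the set of surviving (alive) indices of the
original crease pattern, together with the current positions of the points.
Creases keep their identity (original index) while their positions shift. -/
structure PState where
  alive : Finset ℕ
  pos : ℕ → ℝ

/-- `a` and `b` are adjacent surviving points (no survivor strictly between them). -/
def Adjacent (s : Finset ℕ) (a b : ℕ) : Prop :=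
  a ∈ s ∧ b ∈ s ∧ a < b ∧ ∀ x ∈ s, ¬ (a < x ∧ x < b)

/-- A monocrimp at the adjacent surviving pair `(a, b)`: the two neighboring intervals
are at least as long as the middle one; `a`, `b` are deleted and all later points are
translated by `-2 * (pos b - pos a)`. -/
def Monocrimp (a b : ℕ) (S T : PState) : Prop :=
  Adjacent S.alive a b ∧
  (∃ l, Adjacent S.alive l a ∧ S.pos b - S.pos a ≤ S.pos a - S.pos l) ∧
  (∃ r, Adjacent S.alive b r ∧ S.pos b - S.pos a ≤ S.pos r - S.pos b) ∧
  T.alive = S.alive \ {a, b} ∧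
  T.pos = fun x => if b < x then S.pos x - 2 * (S.pos b - S.pos a) else S.pos x

/-- The set `α` of surviving creases forms a crimpable sequence with gap `d` in state `S`:
`α` is a set of consecutive survivors, equally spaced at distance `d`, and the intervals
adjacent to its two ends are strictly longer than `d`. -/
def CrimpableIn (S : PState) (α : Finset ℕ) (d : ℝ) : Prop :=
  ∃ lo hi, lo ∈ α ∧ hi ∈ α ∧ (∀ x ∈ α, lo ≤ x ∧ x ≤ hi) ∧ 2 ≤ α.card ∧
    α ⊆ S.alive ∧
    (∀ x ∈ S.alive, lo ≤ x → x ≤ hi → x ∈ α) ∧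
    (∀ a b, a ∈ α → b ∈ α → Adjacent S.alive a b → S.pos b - S.pos a = d) ∧
    (∃ l, Adjacent S.alive l lo ∧ d < S.pos lo - S.pos l) ∧
    (∃ r, Adjacent S.alive hi r ∧ d < S.pos r - S.pos hi)

/-- A monocrimp step performed at an adjacent pair of the remaining creases of `α`. -/
def StepIn (α : Finset ℕ) (S T : PState) : Prop :=
  ∃ a b, a ∈ α ∧ b ∈ α ∧ Monocrimp a b S T

/-- A monocrimp step at an adjacent pair of remaining creases of `α` of opposite μ-value. -/
def StepInMV (μ : ℕ → MV) (α : Finset ℕ) (S T : PState) : Prop :=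
  ∃ a b, a ∈ α ∧ b ∈ α ∧ μ a ≠ μ b ∧ Monocrimp a b S T

/-- A crimp operation on the crimpable sequence `α`: a sequence of monocrimps at adjacent
pairs of the remaining creases of `α` until no crease or exactly one crease of `α` remains. -/
def CrimpOp (α : Finset ℕ) (S T : PState) : Prop :=
  (∃ d, CrimpableIn S α d) ∧
  (∃ (m : ℕ) (W : ℕ → PState), W 0 = S ∧ W m = T ∧ (∀ t, t < m → StepIn α (W t) (W (t + 1)))) ∧
  ((T.alive ∩ α).card ≤ 1)

/-- A crimp operation on `α` in which every monocrimp pair has opposite μ-values. -/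
def CrimpOpMV (μ : ℕ → MV) (α : Finset ℕ) (S T : PState) : Prop :=
  (∃ d, CrimpableIn S α d) ∧
  (∃ (m : ℕ) (W : ℕ → PState), W 0 = S ∧ W m = T ∧ (∀ t, t < m → StepInMV μ α (W t) (W (t + 1)))) ∧
  ((T.alive ∩ α).card ≤ 1)

/-- The initial state of the crease pattern `(c 0, …, c n)`. -/
def initState (n : ℕ) (c : ℕ → ℝ) : PState := ⟨Finset.range (n + 1), c⟩

/-- `S 0, …, S m` is a sequence of crimp operations performed on `(c 0, …, c n)`,
with the `t`-th crimp performed on the crimpable sequence `α t`. -/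
def CrimpSeq (n : ℕ) (c : ℕ → ℝ) (m : ℕ) (α : ℕ → Finset ℕ) (S : ℕ → PState) : Prop :=
  S 0 = initState n c ∧ ∀ t, t < m → CrimpOp (α t) (S t) (S (t + 1))

/-- Same, where every monocrimp is performed at a pair of creases of opposite μ-value. -/
def CrimpSeqMV (μ : ℕ → MV) (n : ℕ) (c : ℕ → ℝ) (m : ℕ)
    (α : ℕ → Finset ℕ) (S : ℕ → PState) : Prop :=
  S 0 = initState n c ∧ ∀ t, t < m → CrimpOpMV μ (α t) (S t) (S (t + 1))

/-- The state contains no crimpable sequence (the sequence of crimps was exhaustive). -/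
def Exhausted (S : PState) : Prop := ¬ ∃ α d, CrimpableIn S α d

open Finset in
/-- If `g` has vanishing mixed difference on each square `{2p, 2p+1} × {2q, 2q+1}` with `p < q`,
its alternating sum over `a < b < 2h` reduces to the diagonal terms. -/
theorem alternating_sum_eq_neg_diagonal (g : ℕ → ℕ → ℤ) (h : ℕ)
    (hg : ∀ p q, p < q → q < h →
      g (2 * p) (2 * q) + g (2 * p + 1) (2 * q + 1) =
        g (2 * p) (2 * q + 1) + g (2 * p + 1) (2 * q)) :
    ∑ b ∈ range (2 * h), ∑ a ∈ range b, (-1) ^ (a + b) * g a b =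
      -∑ p ∈ range h, g (2 * p) (2 * p + 1) := by
  induction h with
  | zero => simp
  | succ h ih =>
    have row : ∀ r ≤ h, ∑ a ∈ range (2 * r), (-1) ^ (a + 2 * h) * g a (2 * h) +
        ∑ a ∈ range (2 * r), (-1) ^ (a + (2 * h + 1)) * g a (2 * h + 1) = 0 := by
      intro r hr
      induction r with
      | zero => simp
      | succ r ihr =>
        have h1 := ihr (by omega)
        have h2 := hg r h (by omega) (by omega)
        simp only [Nat.mul_succ, sum_range_succ]
        simp only [pow_add, pow_mul, pow_one, neg_one_sq, one_pow, one_mul, mul_one] at h1 ⊢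
        linarith
    have h1 := ih fun p q hpq hq => hg p q hpq (by omega)
    have h2 := row h le_rfl
    rw [Nat.mul_succ, sum_range_succ, sum_range_succ, h1, sum_range_succ _ h,
      sum_range_succ _ (2 * h)]
    have h3 : (-1 : ℤ) ^ (2 * h + (2 * h + 1)) = -1 := Odd.neg_one_pow ⟨2 * h, by ring⟩
    rw [h3]
    linarith

open Finset in
/-- An alternating sum vanishes if its terms agree on the consecutive pairs `(2t, 2t+1)`. -/
theorem alternating_sum_eq_zero_of_pairs (f : ℕ → ℤ) (h : ℕ)
    (hf : ∀ t < h, f (2 * t) = f (2 * t + 1)) :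
    ∑ a ∈ range (2 * h), (-1) ^ a * f a = 0 := by
  induction h with
  | zero => simp
  | succ h ih =>
    have h1 := ih fun t ht => hf t (by omega)
    have h2 := hf h (by omega)
    simp only [Nat.mul_succ, sum_range_succ, h1]
    simp only [pow_add, pow_mul, pow_one, neg_one_sq, one_pow, one_mul]
    linarith

open Finset in
/-- A discrete turning number theorem: the signed turns along a non-crossing path through
`2h + 2` stacked layers, whose end layers lie outside all arcs of the second side, sum to the
sign of the last layer relative to the first. -/
theorem alternating_sum_path_eq_corner (s : ℕ → ℕ → ℤ) (h : ℕ)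
    (hs : ∀ j l, j < l → l ≤ 2 * h → Even (j + l) →
      s j l + s (j + 1) (l + 1) = s j (l + 1) + s (j + 1) l)
    (hleft : ∀ t < h, s 0 (2 * t + 1) = s 0 (2 * t + 2))
    (hright : ∀ t < h, s (2 * t + 1) (2 * h + 1) = s (2 * t + 2) (2 * h + 1)) :
    ∑ a ∈ range (2 * h + 1), (-1) ^ a * s a (a + 1) = s 0 (2 * h + 1) := by
  have hodd := alternating_sum_eq_neg_diagonal s (h + 1) fun p q hpq hq =>
    hs _ _ (by omega) (by omega) ⟨p + q, by ring⟩
  have heven := alternating_sum_eq_neg_diagonal (fun a b => s (a + 1) (b + 1)) h fun p q hpq hq =>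
    hs _ _ (by omega) (by omega) ⟨p + q + 1, by ring⟩
  have hl := alternating_sum_eq_zero_of_pairs (fun a => s 0 (a + 1)) h hleft
  have hr := alternating_sum_eq_zero_of_pairs (fun a => s (a + 1) (2 * h + 1)) h hright
  have hdiag : ∀ r, ∑ a ∈ range (2 * r + 1), (-1) ^ a * s a (a + 1) =
      ∑ p ∈ range (r + 1), s (2 * p) (2 * p + 1) -
        ∑ p ∈ range r, s (2 * p + 1) (2 * p + 1 + 1) := by
    intro r
    induction r with
    | zero => simp
    | succ r ih =>
      rw [Nat.mul_succ, sum_range_succ, sum_range_succ, ih, sum_range_succ _ (r + 1),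
        sum_range_succ (fun p => s (2 * p + 1) (2 * p + 1 + 1)) r]
      simp only [pow_add, pow_mul, pow_one, neg_one_sq, one_pow, one_mul, mul_one, Nat.mul_succ]
      ring
  have hinner : ∀ b, ∑ a ∈ range (b + 1), (-1) ^ (a + (b + 1)) * s a (b + 1) =
      ∑ a ∈ range b, (-1) ^ (a + b) * s (a + 1) (b + 1) - (-1) ^ b * s 0 (b + 1) := by
    intro b
    rw [sum_range_succ', sub_eq_add_neg]
    congr 1
    · refine sum_congr rfl fun a _ => ?_
      ring
    · ring
  have hsplit : ∑ b ∈ range (2 * h + 2), ∑ a ∈ range b, (-1) ^ (a + b) * s a b =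
      ∑ b ∈ range (2 * h), ∑ a ∈ range b, (-1) ^ (a + b) * s (a + 1) (b + 1) -
        s 0 (2 * h + 1) := by
    rw [sum_range_succ', sum_range_succ]
    simp only [hinner, range_zero, sum_empty, add_zero, sum_sub_distrib, hl]
    simp only [pow_add, pow_mul, neg_one_sq, one_pow, mul_one, one_mul, hr]
    ring
  rw [show 2 * (h + 1) = 2 * h + 2 by ring] at hodd
  rw [hdiag]
  linarith

/-- A finite strict linear order is represented by a rank function. -/
theorem exists_rank (n : ℕ) (lt : ℕ → ℕ → Prop)
    (hirr : ∀ j, j < n → ¬ lt j j) (htrans : ∀ a b e, lt a b → lt b e → lt a e)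
    (htot : ∀ a b, a < n → b < n → a ≠ b → lt a b ∨ lt b a) :
    ∃ r : ℕ → ℕ, ∀ a b, a < n → b < n → (lt a b ↔ r a < r b) := by
  classical
  have mono : ∀ a b, a < n → lt a b →
      ((Finset.range n).filter (lt · a)).card < ((Finset.range n).filter (lt · b)).card := by
    intro a b ha hab
    refine Finset.card_lt_card ⟨fun x hx => ?_, fun hsub => ?_⟩
    · simp only [Finset.mem_filter] at hx ⊢
      exact ⟨hx.1, htrans _ _ _ hx.2 hab⟩
    · have := hsub (Finset.mem_filter.2 ⟨Finset.mem_range.2 ha, hab⟩)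
      exact hirr a ha (Finset.mem_filter.1 this).2
  refine ⟨fun a => ((Finset.range n).filter (lt · a)).card, fun a b ha hb =>
    ⟨mono a b ha, fun hlt => ?_⟩⟩
  by_contra hab
  rcases eq_or_ne a b with rfl | hne
  · exact lt_irrefl _ hlt
  · exact lt_asymm hlt (mono b a hb ((htot a b ha hb hne).resolve_left hab))

theorem foldPos_next (c : ℕ → ℝ) (j : ℕ) : foldPos c j (c (j + 1)) = foldCrease c (j + 1) := by
  simp only [foldCrease, foldPos, foldOffset, pow_succ]
  ring

theorem foldCrease_succ (c : ℕ → ℝ) (j : ℕ) :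
    foldCrease c (j + 1) = foldCrease c j + (-1) ^ j * (c (j + 1) - c j) := by
  rw [← foldPos_next]
  simp only [foldCrease, foldPos]
  ring

theorem foldCrease_of_equal_gaps (c : ℕ → ℝ) (i k : ℕ) (d : ℝ)
    (hgap : ∀ m, i ≤ m → m < i + k → c (m + 1) - c m = d) (j : ℕ) (hj : j ≤ k) :
    foldCrease c (i + j) = foldCrease c i + if Even j then 0 else (-1) ^ i * d := by
  induction j with
  | zero => simp
  | succ j ih =>
    rw [← add_assoc, foldCrease_succ, ih (by omega), hgap _ (by omega) (by omega), pow_add]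
    by_cases hj : Even j
    · simp [hj, Nat.even_add_one]
    · simp [hj, Nat.even_add_one, Nat.not_even_iff_odd.1 hj |>.neg_one_pow]

/-- The sign `+1` of a valley and `-1` of a mountain. -/
def MV.sgn : MV → ℤ
  | MV.M => -1
  | MV.V => 1

theorem MV.sgn_mul_sgn (x y : MV) : x.sgn * y.sgn = if x = y then 1 else -1 := by
  cases x <;> cases y <;> simp [MV.sgn]

theorem MV.sgn_add_sgn_of_ne {x y : MV} (h : x ≠ y) : x.sgn + y.sgn = 0 := by
  cases x <;> cases y <;> simp_all [MV.sgn]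

/-- The sign of `y - x`. -/
def relSign (x y : ℕ) : ℤ := if x < y then 1 else if y < x then -1 else 0

theorem relSign_eq_of_not_between {x y z : ℕ} (hx : z ≠ x) (hy : z ≠ y)
    (h : ¬ (x < z ∧ z < y ∨ y < z ∧ z < x)) : relSign z x = relSign z y := by
  unfold relSign
  split_ifs <;> omega

theorem relSign_eq_of_not_between' {x y z : ℕ} (hx : z ≠ x) (hy : z ≠ y)
    (h : ¬ (x < z ∧ z < y ∨ y < z ∧ z < x)) : relSign x z = relSign y z := by
  unfold relSign
  split_ifs <;> omega

/-- Non-crossing arcs `{x, y}` and `{z, w}` have vanishing mixed difference of relative signs. -/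
theorem relSign_add_of_noncrossing {x y z w : ℕ} (hxz : x ≠ z) (hxw : x ≠ w)
    (hyz : y ≠ z) (hyw : y ≠ w)
    (h : (x < z ∧ z < y ∨ y < z ∧ z < x) ↔ (x < w ∧ w < y ∨ y < w ∧ w < x)) :
    relSign x z + relSign y w = relSign x w + relSign y z := by
  unfold relSign
  split_ifs <;> first | rfl | omega

theorem relSign_eq_sgn {x y e : ℕ} {v : MV} (hxy : x ≠ y)
    (h : x < y ↔ v = MV.V ∧ Even e ∨ v = MV.M ∧ Odd e) : relSign x y = (-1) ^ e * v.sgn := by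
  rcases Nat.even_or_odd e with he | ho
  · have hno := Nat.not_odd_iff_even.2 he
    rw [he.neg_one_pow]
    cases v <;> simp only [he, hno, MV.sgn, reduceCtorEq, and_false, and_true, or_false,
      iff_true, iff_false] at h ⊢ <;> unfold relSign <;> split_ifs <;> omega
  · have hne := Nat.not_even_iff_odd.2 ho
    rw [ho.neg_one_pow]
    cases v <;> simp only [ho, hne, MV.sgn, reduceCtorEq, and_false, and_true, or_false,
      false_or, iff_true, iff_false] at h ⊢ <;> unfold relSign <;> split_ifs <;> omega

theorem mem_Ioo_min_max_of_short (x u d L : ℝ) (hu : u = 1 ∨ u = -1) (hd : 0 < d) (hL : d < L) :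
    x + u * d ∈ Set.Ioo (min x (x + u * L)) (max x (x + u * L)) := by
  rw [Set.mem_Ioo, min_lt_iff, lt_max_iff]
  rcases hu with rfl | rfl
  · exact ⟨Or.inl (by linarith), Or.inr (by linarith)⟩
  · exact ⟨Or.inr (by linarith), Or.inl (by linarith)⟩

/-- In a flat-foldable pattern, the mountains and valleys of a crimpable sequence with an odd
number of creases differ in number by exactly one. -/
theorem sum_sgn_crimpable (n : ℕ) (c : ℕ → ℝ) (μ : ℕ → MV)
    (hC : IsCreasePattern n c) (hF : IsFlatFoldable n c μ)
    (i k : ℕ) (d : ℝ) (hα : IsCrimpable n c i k d) (hk : Even k) :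
    |∑ x ∈ Finset.Icc i (i + k), (μ x).sgn| = 1 := by
  obtain ⟨lt, hirr, htrans, htot, -, hlabel, hcross, hnest⟩ := hF
  obtain ⟨r, hr⟩ := exists_rank n lt hirr htrans htot
  have hinj : ∀ a b, a < n → b < n → a ≠ b → r a ≠ r b := by
    intro a b ha hb hab
    rcases htot a b ha hb hab with h | h
    · exact ((hr a b ha hb).1 h).ne
    · exact ((hr b a hb ha).1 h).ne'
  obtain ⟨hi, hk1, hin, hgap, hgl, hgr⟩ := hα
  obtain ⟨o, rfl⟩ : ∃ o, i = o + 1 := ⟨i - 1, by omega⟩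
  obtain ⟨h, rfl⟩ : ∃ h, k = 2 * h := hk.two_dvd
  simp only [Nat.add_sub_cancel] at hgl
  have hd : 0 < d := by
    have h1 := hgap (o + 1) le_rfl (by omega)
    have h2 := hC.2 (o + 1) (o + 1 + 1) (by omega) (by omega)
    linarith
  have hpos := foldCrease_of_equal_gaps c (o + 1) (2 * h) d hgap
  have hside : ∀ t < h,
      foldCrease c (o + (2 * t + 1) + 1) = foldCrease c (o + 1) + (-1) ^ (o + 1) * d := by
    intro t ht
    have := hpos (2 * t + 1) (by omega)
    rw [if_neg (by simp)] at this
    rw [← this]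
    congr 1
    ring
  have hunit := neg_one_pow_eq_or ℝ (o + 1)
  have hfirst : ∀ t < h, ¬ Between lt (o + (2 * t + 1)) (o + (2 * t + 1) + 1) o := by
    intro t ht
    refine hcross (o + (2 * t + 1) + 1) (by omega) (by omega) o (by omega) ?_
    rw [hside t ht, foldPos_next]
    have h1 := foldCrease_succ c o
    have h2 := mem_Ioo_min_max_of_short (foldCrease c (o + 1)) _ d _ hunit hd hgl
    have h3 : foldPos c o (c o) = foldCrease c (o + 1) + (-1) ^ (o + 1) * (c (o + 1) - c o) := by
      rw [h1, pow_succ, foldCrease]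
      ring
    rwa [h3, min_comm, max_comm]
  have hlast : ∀ t < h,
      ¬ Between lt (o + (2 * t + 1)) (o + (2 * t + 1) + 1) (o + (2 * h + 1)) := by
    intro t ht
    refine hcross (o + (2 * t + 1) + 1) (by omega) (by omega) _ (by omega) ?_
    rw [hside t ht, foldPos_next]
    have h1 := hpos (2 * h) le_rfl
    rw [if_pos (by simp), add_zero] at h1
    have h2 := mem_Ioo_min_max_of_short (foldCrease c (o + 1)) _ d _ hunit hd hgr
    have h3 := foldCrease_succ c (o + 1 + 2 * h)
    have h4 : (-1 : ℝ) ^ (o + 1 + 2 * h) = (-1) ^ (o + 1) := by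
      rw [pow_add _ (o + 1), pow_mul, neg_one_sq, one_pow, mul_one]
    rw [h1, h4] at h3
    rw [show o + (2 * h + 1) = o + 1 + 2 * h by ring, h3]
    change _ ∈ Set.Ioo (min (foldCrease c (o + 1 + 2 * h)) _)
      (max (foldCrease c (o + 1 + 2 * h)) _)
    rwa [h1]
  have hsame : ∀ j l, j ≤ 2 * h → l ≤ 2 * h → Even (j + l) → j ≠ l →
      (Between lt (o + j) (o + (j + 1)) (o + l) ↔
        Between lt (o + j) (o + (j + 1)) (o + (l + 1))) := by
    intro j l hj hl hjl hne
    refine hnest (o + (j + 1)) (o + (l + 1)) (by omega) (by omega) (by omega) (by omega)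
      (by omega) ?_
    have h1 := hpos j hj
    have h2 := hpos l hl
    rw [show o + (j + 1) = o + 1 + j by ring, show o + (l + 1) = o + 1 + l by ring, h1, h2]
    simp only [Nat.even_add.1 hjl]
  have hturn := alternating_sum_path_eq_corner (fun a b => relSign (r (o + a)) (r (o + b))) h
    (by
      intro j l hjl hl hpar
      have h1 := hsame j l (by omega) hl hpar hjl.ne
      have hne : l ≠ j + 1 := by
        rintro rfl
        rw [Nat.even_iff] at hpar
        omega
      have d1 := hinj (o + j) (o + l) (by omega) (by omega) (by omega)
      have d2 := hinj (o + j) (o + (l + 1)) (by omega) (by omega) (by omega)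
      have d3 := hinj (o + (j + 1)) (o + l) (by omega) (by omega) (by omega)
      have d4 := hinj (o + (j + 1)) (o + (l + 1)) (by omega) (by omega) (by omega)
      simp (disch := omega) only [Between, hr] at h1
      exact relSign_add_of_noncrossing d1 d2 d3 d4 h1)
    (by
      intro t ht
      have h1 := hfirst t ht
      have d1 := hinj o (o + (2 * t + 1)) (by omega) (by omega) (by omega)
      have d2 := hinj o (o + (2 * t + 1) + 1) (by omega) (by omega) (by omega)
      simp (disch := omega) only [Between, hr] at h1
      exact relSign_eq_of_not_between d1 d2 h1)
    (by
      intro t ht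
      have h1 := hlast t ht
      have d1 := hinj (o + (2 * h + 1)) (o + (2 * t + 1)) (by omega) (by omega) (by omega)
      have d2 := hinj (o + (2 * h + 1)) (o + (2 * t + 1) + 1) (by omega) (by omega) (by omega)
      simp (disch := omega) only [Between, hr] at h1
      exact relSign_eq_of_not_between' d1 d2 h1)
  have hterm : ∀ a ∈ Finset.range (2 * h + 1),
      (-1) ^ a * relSign (r (o + a)) (r (o + (a + 1))) = (-1) ^ o * (μ (o + 1 + a)).sgn := by
    intro a ha
    rw [Finset.mem_range] at ha
    have h1 := hlabel (o + 1 + a) (by omega) (by omega)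
    rw [show o + 1 + a - 1 = o + a by omega, show o + 1 + a = o + (a + 1) by ring] at h1
    rw [hr _ _ (by omega) (by omega)] at h1
    have d1 := hinj (o + a) (o + (a + 1)) (by omega) (by omega) (by omega)
    rw [show o + 1 + a = o + (a + 1) by ring]
    rw [relSign_eq_sgn d1 h1, ← mul_assoc, ← pow_add, show a + (o + a) = 2 * a + o by ring,
      pow_add, pow_mul, neg_one_sq, one_pow, one_mul]
  have hsum : ∑ x ∈ Finset.Icc (o + 1) (o + 1 + 2 * h), (μ x).sgn =
      ∑ a ∈ Finset.range (2 * h + 1), (μ (o + 1 + a)).sgn := by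
    rw [← Finset.Ico_succ_right_eq_Icc, Finset.sum_Ico_eq_sum_range]
    congr 2
    simp only [Order.succ_eq_add_one]
    omega
  rw [Finset.sum_congr rfl hterm, ← Finset.mul_sum, ← hsum] at hturn
  have hcorner : |relSign (r (o + 0)) (r (o + (2 * h + 1)))| = 1 := by
    have d1 := hinj (o + 0) (o + (2 * h + 1)) (by omega) (by omega) (by omega)
    unfold relSign
    split_ifs <;> first | rfl | omega
  rw [← hturn, abs_mul, abs_pow, abs_neg, abs_one, one_pow, one_mul] at hcorner
  exact hcorner

/-- The invariant of monocrimping within the creases `i, …, i+k`: points outside stay alive,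
consecutive survivors are at distance at least `d` from `i-1` to `i+k+1`, with equality among
the creases of the sequence. -/
def CrimpInvariant (n i k : ℕ) (d : ℝ) (S : PState) : Prop :=
  (∀ x ≤ n, x ∉ Finset.Icc i (i + k) → x ∈ S.alive) ∧
  (∀ x y, i - 1 ≤ x → y ≤ i + k + 1 → Adjacent S.alive x y → d ≤ S.pos y - S.pos x) ∧
  (∀ x y, i ≤ x → y ≤ i + k → Adjacent S.alive x y → S.pos y - S.pos x = d)

theorem crimpInvariant_init (n : ℕ) (c : ℕ → ℝ) (i k : ℕ) (d : ℝ) (hα : IsCrimpable n c i k d) :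
    CrimpInvariant n i k d (initState n c) := by
  obtain ⟨hi, hk1, hin, hgap, hgl, hgr⟩ := hα
  have hadj : ∀ x y, Adjacent (initState n c).alive x y → y = x + 1 := by
    rintro x y ⟨-, hy, hxy, hnone⟩
    by_contra hne
    simp only [initState, Finset.mem_range] at hy hnone
    exact hnone (x + 1) (by omega) ⟨by omega, by omega⟩
  refine ⟨fun x hx _ => Finset.mem_range.2 (by omega), fun x y hx hy h => ?_, fun x y hx hy h => ?_⟩
  · obtain rfl := hadj x y h
    simp only [initState]
    rcases Nat.lt_or_ge x i with h1 | h1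
    · obtain rfl : i = x + 1 := by omega
      exact hgl.le
    · rcases Nat.lt_or_ge x (i + k) with h2 | h2
      · exact (hgap x h1 h2).ge
      · obtain rfl : x = i + k := by omega
        exact hgr.le
  · obtain rfl := hadj x y h
    exact hgap x hx (by omega)

theorem CrimpInvariant.monocrimp {n i k : ℕ} {d : ℝ} {a b : ℕ} {S T : PState}
    (hS : CrimpInvariant n i k d S) (ha : a ∈ Finset.Icc i (i + k)) (hb : b ∈ Finset.Icc i (i + k))
    (h : Monocrimp a b S T) : CrimpInvariant n i k d T := by
  obtain ⟨hout, hge, heq⟩ := hS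
  obtain ⟨hab, -, -, halive, hpos⟩ := h
  rw [Finset.mem_Icc] at ha hb
  have hd := heq a b ha.1 hb.2 hab
  have hmem : ∀ x, x ∈ T.alive ↔ x ∈ S.alive ∧ x ≠ a ∧ x ≠ b := by
    intro x
    simp [halive]
  have hcases : ∀ x y, Adjacent T.alive x y →
      (Adjacent S.alive x y ∧ T.pos y - T.pos x = S.pos y - S.pos x) ∨
      (x < a ∧ b < y ∧ Adjacent S.alive x a ∧ Adjacent S.alive b y ∧
        T.pos y - T.pos x = (S.pos y - S.pos b) + (S.pos a - S.pos x) - d) := by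
    rintro x y ⟨hx, hy, hxy, hnone⟩
    obtain ⟨hx, hxa, hxb⟩ := (hmem x).1 hx
    obtain ⟨hy, hya, hyb⟩ := (hmem y).1 hy
    obtain ⟨haS, hbS, hlt, hnab⟩ := hab
    have hx' : x < a ∨ b < x := by
      by_contra hcon
      exact hnab x hx ⟨by omega, by omega⟩
    have hy' : y < a ∨ b < y := by
      by_contra hcon
      exact hnab y hy ⟨by omega, by omega⟩
    have hnone' : ∀ z ∈ S.alive, x < z → z < y → z = a ∨ z = b := by
      intro z hz h1 h2
      by_contra hcon
      exact hnone z ((hmem z).2 ⟨hz, by tauto⟩) ⟨h1, h2⟩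
    by_cases hmid : x < a ∧ b < y
    · refine Or.inr ⟨hmid.1, hmid.2, ⟨hx, haS, hmid.1, ?_⟩, ⟨hbS, hy, hmid.2, ?_⟩, ?_⟩
      · rintro z hz ⟨h1, h2⟩
        rcases hnone' z hz h1 (by omega) with h3 | h3 <;> omega
      · rintro z hz ⟨h1, h2⟩
        rcases hnone' z hz (by omega) h2 with h3 | h3 <;> omega
      · simp only [hpos, if_pos hmid.2, if_neg (show ¬ b < x by omega)]
        linarith
    · refine Or.inl ⟨⟨hx, hy, hxy, ?_⟩, ?_⟩
      · rintro z hz ⟨h1, h2⟩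
        rcases hnone' z hz h1 h2 with h3 | h3 <;> omega
      · simp only [hpos]
        by_cases hbx : b < x
        · rw [if_pos hbx, if_pos (by omega)]
          ring
        · rw [if_neg hbx, if_neg (by omega)]
  refine ⟨fun x hx hxα => (hmem x).2 ⟨hout x hx hxα, ?_, ?_⟩, fun x y hx hy h => ?_,
    fun x y hx hy h => ?_⟩
  · rintro rfl
    exact hxα (Finset.mem_Icc.2 ha)
  · rintro rfl
    exact hxα (Finset.mem_Icc.2 hb)
  · rcases hcases x y h with ⟨h1, h2⟩ | ⟨-, -, h1, h2, h3⟩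
    · rw [h2]
      exact hge x y hx hy h1
    · have h4 := hge x a hx (by omega) h1
      have h5 := hge b y (by omega) hy h2
      linarith
  · rcases hcases x y h with ⟨h1, h2⟩ | ⟨-, -, h1, h2, h3⟩
    · rw [h2]
      exact heq x y hx hy h1
    · have h4 := heq x a hx (by omega) h1
      have h5 := heq b y (by omega) hy h2
      linarith

theorem exists_adjacent_left (s : Finset ℕ) {x a : ℕ} (hx : x ∈ s) (ha : a ∈ s) (hxa : x < a) :
    ∃ l, x ≤ l ∧ Adjacent s l a := by
  have hne : (s.filter (· < a)).Nonempty := ⟨x, Finset.mem_filter.2 ⟨hx, hxa⟩⟩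
  have hmax := Finset.mem_filter.1 (Finset.max'_mem _ hne)
  refine ⟨_, Finset.le_max' _ _ (Finset.mem_filter.2 ⟨hx, hxa⟩), hmax.1, ha, hmax.2, ?_⟩
  rintro z hz ⟨h1, h2⟩
  exact absurd (Finset.le_max' _ z (Finset.mem_filter.2 ⟨hz, h2⟩)) (not_le.2 h1)

theorem exists_adjacent_right (s : Finset ℕ) {x b : ℕ} (hx : x ∈ s) (hb : b ∈ s) (hbx : b < x) :
    ∃ r, r ≤ x ∧ Adjacent s b r := by
  have hne : (s.filter (b < ·)).Nonempty := ⟨x, Finset.mem_filter.2 ⟨hx, hbx⟩⟩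
  have hmin := Finset.mem_filter.1 (Finset.min'_mem _ hne)
  refine ⟨_, Finset.min'_le _ _ (Finset.mem_filter.2 ⟨hx, hbx⟩), hb, hmin.1, hmin.2, ?_⟩
  rintro z hz ⟨h1, h2⟩
  exact absurd (Finset.min'_le _ z (Finset.mem_filter.2 ⟨hz, h1⟩)) (not_le.2 h2)

theorem exists_adjacent_ne {β : Type*} (s : Finset ℕ) (f : ℕ → β) {x y : ℕ} (hx : x ∈ s)
    (hy : y ∈ s) (hxy : x < y) (hf : f x ≠ f y) :
    ∃ a b, x ≤ a ∧ b ≤ y ∧ f a ≠ f b ∧ Adjacent s a b := by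
  induction hm : y - x using Nat.strong_induction_on generalizing x y with
  | _ m ih =>
    subst hm
    by_cases hz : ∃ z ∈ s, x < z ∧ z < y
    · obtain ⟨z, hz, h1, h2⟩ := hz
      by_cases hxz : f x = f z
      · obtain ⟨a, b, h3, h4, h5⟩ := ih (y - z) (by omega) hz hy h2 (hxz ▸ hf) rfl
        exact ⟨a, b, by omega, h4, h5⟩
      · obtain ⟨a, b, h3, h4, h5⟩ := ih (z - x) (by omega) hx hz h1 hxz rfl
        exact ⟨a, b, h3, by omega, h5⟩
    · push Not at hz
      exact ⟨x, y, le_rfl, le_rfl, hf, hx, hy, hxy, fun z hzs ⟨h1, h2⟩ =>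
        absurd h2 (not_lt.2 (hz z hzs h1))⟩

theorem CrimpInvariant.exists_stepInMV {n i k : ℕ} {d : ℝ} {S : PState} {μ : ℕ → MV}
    (hS : CrimpInvariant n i k d S) (hi : 1 ≤ i) (hn : i + k + 1 ≤ n) {x y : ℕ}
    (hx : x ∈ S.alive ∩ Finset.Icc i (i + k)) (hy : y ∈ S.alive ∩ Finset.Icc i (i + k))
    (hxy : x < y) (hμ : μ x ≠ μ y) : ∃ T, StepInMV μ (Finset.Icc i (i + k)) S T := by
  obtain ⟨hout, hge, heq⟩ := hS
  rw [Finset.mem_inter, Finset.mem_Icc] at hx hy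
  obtain ⟨a, b, hxa, hby, hne, hab⟩ := exists_adjacent_ne S.alive μ hx.1 hy.1 hxy hμ
  have hlt := hab.2.2.1
  obtain ⟨l, hl, hla⟩ := exists_adjacent_left S.alive
    (hout (i - 1) (by omega) (by simp; omega)) hab.1 (by omega)
  obtain ⟨r, hr, hbr⟩ := exists_adjacent_right S.alive
    (hout (i + k + 1) (by omega) (by simp)) hab.2.1 (by omega)
  have h1 := heq a b (by omega) (by omega) hab
  have h2 := hge l a hl (by omega) hla
  have h3 := hge b r (by omega) hr hbr
  exact ⟨⟨_, _⟩, a, b, Finset.mem_Icc.2 (by omega), Finset.mem_Icc.2 (by omega), hne, hab,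
    ⟨l, hla, by linarith⟩, ⟨r, hbr, by linarith⟩, rfl, rfl⟩

theorem StepInMV.sum_sgn_eq {μ : ℕ → MV} {α : Finset ℕ} {S T : PState} (h : StepInMV μ α S T) :
    ∑ x ∈ T.alive ∩ α, (μ x).sgn = ∑ x ∈ S.alive ∩ α, (μ x).sgn := by
  obtain ⟨a, b, ha, hb, hne, ⟨haS, hbS, hlt, -⟩, -, -, halive, -⟩ := h
  have hsub : {a, b} ⊆ S.alive ∩ α := by
    simp [Finset.insert_subset_iff, ha, hb, haS, hbS]
  have hT : T.alive ∩ α = (S.alive ∩ α) \ {a, b} := by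
    rw [halive, Finset.sdiff_inter_right_comm]
  rw [hT, ← Finset.sum_sdiff hsub, Finset.sum_pair hlt.ne, MV.sgn_add_sgn_of_ne hne, add_zero]

/-- Let `(C, μ)` be flat-foldable and `α = (c i, …, c (i+k))` a crimpable sequence with
an odd number `k + 1` of creases (`k` even).  Any maximal sequence of monocrimps, each
performed at an adjacent pair of the remaining creases of `α` of opposite μ-value,
removes all but exactly one crease of `α`; moreover the surviving crease carries the
majority μ-value, i.e. the value taken by exactly `k/2 + 1` of the creases of `α`. -/
theorem crimp_survivor_majority (n : ℕ) (c : ℕ → ℝ) (μ : ℕ → MV)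
    (hC : IsCreasePattern n c) (hF : IsFlatFoldable n c μ)
    (i k : ℕ) (d : ℝ) (hα : IsCrimpable n c i k d) (hodd : Odd (k + 1))
    (m : ℕ) (S : ℕ → PState)
    (hinit : S 0 = initState n c)
    (hstep : ∀ t, t < m → StepInMV μ (Finset.Icc i (i + k)) (S t) (S (t + 1)))
    (hmax : ∀ T, ¬ StepInMV μ (Finset.Icc i (i + k)) (S m) T) :
    ∃ s ∈ Finset.Icc i (i + k),
      (S m).alive ∩ Finset.Icc i (i + k) = {s} ∧
      ((Finset.Icc i (i + k)).filter (fun x => μ x = μ s)).card = k / 2 + 1 := by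
  have hα' := hα
  obtain ⟨hi, hk1, hin, -⟩ := hα'
  have hk : Even k := by
    rw [Nat.odd_add_one, Nat.not_odd_iff_even] at hodd
    exact hodd
  have habs := sum_sgn_crimpable n c μ hC hF i k d hα hk
  have hinv : ∀ t ≤ m, CrimpInvariant n i k d (S t) ∧
      ∑ x ∈ (S t).alive ∩ Finset.Icc i (i + k), (μ x).sgn =
        ∑ x ∈ Finset.Icc i (i + k), (μ x).sgn := by
    intro t ht
    induction t with
    | zero =>
      rw [hinit]
      refine ⟨crimpInvariant_init n c i k d hα, ?_⟩
      congr 1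
      refine Finset.inter_eq_right.2 fun x hx => ?_
      rw [Finset.mem_Icc] at hx
      exact Finset.mem_range.2 (by omega)
    | succ t ih =>
      obtain ⟨h1, h2⟩ := ih (by omega)
      have h3 := hstep t (by omega)
      refine ⟨?_, h3.sum_sgn_eq.trans h2⟩
      obtain ⟨a, b, ha, hb, -, h4⟩ := h3
      exact h1.monocrimp ha hb h4
  obtain ⟨hI, hsum⟩ := hinv m le_rfl
  set A := (S m).alive ∩ Finset.Icc i (i + k) with hA
  have hmono : ∀ x ∈ A, ∀ y ∈ A, μ x = μ y := by
    intro x hx y hy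
    by_contra hne
    rcases lt_trichotomy x y with hlt | rfl | hlt
    · obtain ⟨T, hT⟩ := hI.exists_stepInMV hi (by omega) hx hy hlt hne
      exact hmax T hT
    · exact hne rfl
    · obtain ⟨T, hT⟩ := hI.exists_stepInMV hi (by omega) hy hx hlt (Ne.symm hne)
      exact hmax T hT
  obtain ⟨s, hs⟩ : A.Nonempty := by
    rw [Finset.nonempty_iff_ne_empty]
    intro hempty
    rw [hempty, Finset.sum_empty] at hsum
    simp [← hsum] at habs
  have hAsum : ∑ x ∈ A, (μ x).sgn = A.card * (μ s).sgn := by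
    rw [Finset.sum_congr rfl fun x hx => by rw [hmono x hx s hs], Finset.sum_const, nsmul_eq_mul]
  have hsq : (μ s).sgn * (μ s).sgn = 1 := by
    rw [MV.sgn_mul_sgn, if_pos rfl]
  have hunit : |(μ s).sgn| = 1 := by
    cases μ s <;> rfl
  have hcard : A.card = 1 := by
    rw [← hsum, hAsum, abs_mul, hunit, mul_one, Nat.abs_cast] at habs
    exact_mod_cast habs
  have hsingle : A = {s} := by
    obtain ⟨u, hu⟩ := Finset.card_eq_one.1 hcard
    rw [hu, Finset.mem_singleton] at hs
    rw [hu, hs]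
  refine ⟨s, (Finset.mem_inter.1 hs).2, hsingle, ?_⟩
  have htotal : ∑ x ∈ Finset.Icc i (i + k), (μ x).sgn * (μ s).sgn = 1 := by
    rw [← Finset.sum_mul, ← hsum, hsingle, Finset.sum_singleton, hsq]
  simp only [MV.sgn_mul_sgn, Finset.sum_ite, Finset.sum_const, nsmul_eq_mul, mul_one] at htotal
  have hsplit := Finset.card_filter_add_card_filter_not (s := Finset.Icc i (i + k))
    (fun x => μ x = μ s)
  rw [Nat.card_Icc] at hsplit
  obtain ⟨h, rfl⟩ := hk
  omega
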